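/- arXiv:1810.05597 — 3 statements merged into one kernel-verified Lean document; each statement's English description precedes it below -/
import Mathlib

section
/- (Quantitative approximate local isometry of Theorem 1.) For all x, Δx ∈ ℝ², the deviation from the magnified local isometry is fourth order in Δx: |Re⟨v(x), v(x + Δx)⟩ − 3(1 − α‖Δx‖²)| ≤ α²‖Δx‖⁴. -/
open Matrix RealInnerProductSpace

noncomputable section

/-- The map `e : ℝ² → ℂ³`, `e(x)ⱼ = exp(i⟨aⱼ, x⟩)`. -/
def gridE (a : Fin 3 → EuclideanSpace ℝ (Fin 2)) (x : EuclideanSpace ℝ (Fin 2)) :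
    Fin 3 → ℂ :=
  fun j => Complex.exp (Complex.I * ((⟪a j, x⟫ : ℝ) : ℂ))

/-- The diagonal matrix `D(Δx)` with diagonal entries `exp(i⟨aⱼ, Δx⟩)`. -/
def gridD (a : Fin 3 → EuclideanSpace ℝ (Fin 2)) (dx : EuclideanSpace ℝ (Fin 2)) :
    Matrix (Fin 3) (Fin 3) ℂ :=
  Matrix.diagonal (gridE a dx)

/-- `v(x) = C e(x)`. -/
def gridV (C : Matrix (Fin 3) (Fin 3) ℂ) (a : Fin 3 → EuclideanSpace ℝ (Fin 2))
    (x : EuclideanSpace ℝ (Fin 2)) : Fin 3 → ℂ :=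
  C.mulVec (gridE a x)

/-- `M(Δx) = C D(Δx) C*`. -/
def gridM (C : Matrix (Fin 3) (Fin 3) ℂ) (a : Fin 3 → EuclideanSpace ℝ (Fin 2))
    (dx : EuclideanSpace ℝ (Fin 2)) : Matrix (Fin 3) (Fin 3) ℂ :=
  C * gridD a dx * Cᴴ

/-- The Hermitian inner product `⟨u, w⟩ = u* w` on `ℂ³`,
conjugate-linear in the first argument. -/
def hermInner (u w : Fin 3 → ℂ) : ℂ :=
  ∑ j, star (u j) * w j

/-- The quadratic Taylor polynomial of `cos` at `0` has error at most `t ^ 4 / 24`. -/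
lemma abs_cos_sub_one_add_sq_div_two_le (t : ℝ) :
    |Real.cos t - (1 - t ^ 2 / 2)| ≤ t ^ 4 / 24 := by
  have upper : ∀ s : ℝ, 0 ≤ s → Real.cos s ≤ 1 - s ^ 2 / 2 + s ^ 4 / 24 := by
    intro s hs
    have hcos : Real.cos s = 1 - 2 * Real.sin (s / 2) ^ 2 := by
      have h := Real.cos_two_mul (s / 2)
      rw [mul_div_cancel₀ s two_ne_zero, Real.cos_sq'] at h
      linarith
    have hsin := Real.sin_ge_sub_cube (by positivity : 0 ≤ s / 2)
    generalize Real.sin (s / 2) = z at *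
    have hz : (s / 2) ^ 2 - (s / 2) ^ 4 / 3 ≤ z ^ 2 := by
      rcases le_total 0 (s / 2 - (s / 2) ^ 3 / 6) with h | h
      · nlinarith [pow_le_pow_left₀ h hsin 2, pow_nonneg hs 6]
      · nlinarith [mul_nonneg hs (sub_nonneg.mpr h), sq_nonneg z, pow_nonneg hs 4]
    rw [hcos]
    linarith
  have hlow := Real.one_sub_sq_div_two_le_cos (x := t)
  have hup := upper |t| (abs_nonneg t)
  rw [Real.cos_abs, sq_abs, Even.pow_abs (by decide : Even 4)] at hup
  rw [abs_le]
  constructor <;> nlinarith [sq_nonneg (t ^ 2)]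

/-- `C` preserves the Hermitian inner product when `Cᴴ * C = 1`. -/
lemma hermInner_mulVec_mulVec {C : Matrix (Fin 3) (Fin 3) ℂ} (hC : Cᴴ * C = 1)
    (u w : Fin 3 → ℂ) : hermInner (C.mulVec u) (C.mulVec w) = hermInner u w := by
  change star (C *ᵥ u) ⬝ᵥ (C *ᵥ w) = star u ⬝ᵥ w
  rw [star_mulVec, ← dotProduct_mulVec, mulVec_mulVec, hC, one_mulVec]

lemma re_hermInner_gridE_add (a : Fin 3 → EuclideanSpace ℝ (Fin 2))
    (x dx : EuclideanSpace ℝ (Fin 2)) :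
    (hermInner (gridE a x) (gridE a (x + dx))).re = ∑ j, Real.cos ⟪a j, dx⟫ := by
  simp only [hermInner, gridE, Complex.re_sum]
  refine Finset.sum_congr rfl fun j _ => ?_
  have h : star (Complex.exp (Complex.I * ((⟪a j, x⟫ : ℝ) : ℂ))) *
      Complex.exp (Complex.I * ((⟪a j, x + dx⟫ : ℝ) : ℂ)) =
        Complex.exp (((⟪a j, dx⟫ : ℝ) : ℂ) * Complex.I) := by
    rw [Complex.star_def, ← Complex.exp_conj, ← Complex.exp_add, inner_add_right]
    congr 1
    simp only [map_mul, Complex.conj_I, Complex.conj_ofReal, Complex.ofReal_add]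
    ring
  rw [h, Complex.exp_ofReal_mul_I_re]

/-- Three equiangular vectors of equal norm in the plane form a tight frame with sum zero. -/
lemma sum_inner_and_sum_inner_sq {α : ℝ} (hα : 0 < α)
    {a : Fin 3 → EuclideanSpace ℝ (Fin 2)}
    (hnorm : ∀ j, ‖a j‖ = 2 * Real.sqrt α)
    (hang : ∀ i j, i ≠ j → ⟪a i, a j⟫ = -2 * α) (y : EuclideanSpace ℝ (Fin 2)) :
    ∑ j, ⟪a j, y⟫ = 0 ∧ ∑ j, ⟪a j, y⟫ ^ 2 = 6 * α * ‖y‖ ^ 2 := by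
  have hsq : ∀ j, ⟪a j, a j⟫ = 4 * α := fun j => by
    rw [real_inner_self_eq_norm_sq, hnorm, mul_pow, Real.sq_sqrt hα.le]
    norm_num
  have hsum : a 0 + a 1 + a 2 = 0 := by
    rw [← inner_self_eq_zero (𝕜 := ℝ)]
    simp only [inner_add_left, inner_add_right, hsq]
    rw [hang 0 1 (by decide), hang 0 2 (by decide), hang 1 0 (by decide),
      hang 1 2 (by decide), hang 2 0 (by decide), hang 2 1 (by decide)]
    ring
  have h0 := hsq 0
  have h1 := hsq 1
  have h01 := hang 0 1 (by decide)
  have h2 : a 2 = -(a 0 + a 1) := (neg_eq_of_add_eq_zero_right hsum).symm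
  rw [← real_inner_self_eq_norm_sq]
  simp only [Fin.sum_univ_three, h2, inner_neg_left, inner_add_left]
  refine ⟨by ring, ?_⟩
  simp only [PiLp.inner_apply, Fin.sum_univ_two, RCLike.inner_apply, conj_trivial]
    at h0 h1 h01 ⊢
  generalize a 0 0 = p at *
  generalize a 0 1 = q at *
  generalize a 1 0 = r at *
  generalize a 1 1 = s at *
  have hdet : (p * s - q * r) ^ 2 = 12 * α ^ 2 := by
    linear_combination (r * r + s * s) * h0 + 4 * α * h1 - (r * p + s * q - 2 * α) * h01
  have hne : p * s - q * r ≠ 0 := by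
    intro h
    rw [h] at hdet
    nlinarith [pow_pos hα 2]
  have e1 : p * p + r * r + (p + r) * (p + r) = 6 * α := by
    refine mul_left_cancel₀ hne ?_
    linear_combination s * ((2 * p + r) * h0 + (p + 2 * r) * h01)
      - q * ((p + 2 * r) * h1 + (2 * p + r) * h01)
  have e2 : q * q + s * s + (q + s) * (q + s) = 6 * α := by
    refine mul_left_cancel₀ hne ?_
    linear_combination -r * ((2 * q + s) * h0 + (q + 2 * s) * h01)
      + p * ((q + 2 * s) * h1 + (2 * q + s) * h01)
  have e3 : p * q + r * s + (p + r) * (q + s) = 0 := by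
    refine mul_left_cancel₀ hne ?_
    linear_combination -r * ((2 * p + r) * h0 + (p + 2 * r) * h01)
      + p * ((p + 2 * r) * h1 + (2 * p + r) * h01)
  linear_combination y 0 ^ 2 * e1 + y 1 ^ 2 * e2 + 2 * y 0 * y 1 * e3

/-- quantitative approximate local isometry of Theorem 1:
`|Re⟨v(x), v(x+Δx)⟩ − 3(1 − α‖Δx‖²)| ≤ α²‖Δx‖⁴`. -/
theorem grid_approx_local_isometry (α : ℝ) (hα : 0 < α)
    (a : Fin 3 → EuclideanSpace ℝ (Fin 2))
    (hnorm : ∀ j, ‖a j‖ = 2 * Real.sqrt α)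
    (hang : ∀ i j, i ≠ j → ⟪a i, a j⟫ = -2 * α)
    (C : Matrix (Fin 3) (Fin 3) ℂ) (hC : Cᴴ * C = 1) :
    ∀ x dx : EuclideanSpace ℝ (Fin 2),
      |(hermInner (gridV C a x) (gridV C a (x + dx))).re - 3 * (1 - α * ‖dx‖ ^ 2)|
        ≤ α ^ 2 * ‖dx‖ ^ 4 := by
  intro x dx
  obtain ⟨hsum, hsq⟩ := sum_inner_and_sum_inner_sq hα hnorm hang dx
  have hb := fun j => abs_le.mp (abs_cos_sub_one_add_sq_div_two_le ⟪a j, dx⟫)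
  rw [gridV, gridV, hermInner_mulVec_mulVec hC, re_hermInner_gridE_add]
  simp only [Fin.sum_univ_three] at hsum hsq ⊢
  have h0 := hb 0
  have h1 := hb 1
  have h2 := hb 2
  generalize ⟪a 0, dx⟫ = t₀ at *
  generalize ⟪a 1, dx⟫ = t₁ at *
  generalize ⟪a 2, dx⟫ = t₂ at *
  have hquart : t₀ ^ 4 + t₁ ^ 4 + t₂ ^ 4 = 18 * (α ^ 2 * ‖dx‖ ^ 4) := by
    obtain rfl : t₂ = -(t₀ + t₁) := by linarith
    linear_combination
      (t₀ ^ 2 + t₁ ^ 2 + (t₀ + t₁) ^ 2 + 6 * α * ‖dx‖ ^ 2) / 2 * hsq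
  have hnonneg : 0 ≤ α ^ 2 * ‖dx‖ ^ 4 := by positivity
  rw [abs_le]
  constructor <;> linarith [h0.1, h0.2, h1.1, h1.2, h2.1, h2.2]
end
end

section
/- (Global ambiguity of a single block.) The vectors a₁ and a₂ are linearly independent, and there exists a nonzero z ∈ ℝ² such that v(x + z) = v(x) for every x ∈ ℝ². In particular the map x ↦ v(x) is not injective on ℝ², so a single block does not encode position uniquely. -/
open Matrix RealInnerProductSpace

noncomputable section

/-- Shifting by a vector whose inner products with the `aⱼ` are all multiples of `2π` does not
change `v`. -/
lemma gridV_add_eq_of_inner_eq_int_mul (C : Matrix (Fin 3) (Fin 3) ℂ)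
    {a : Fin 3 → EuclideanSpace ℝ (Fin 2)} {z : EuclideanSpace ℝ (Fin 2)}
    (hz : ∀ j, ∃ n : ℤ, ⟪a j, z⟫ = n * (2 * Real.pi)) (x : EuclideanSpace ℝ (Fin 2)) :
    gridV C a (x + z) = gridV C a x := by
  have hE : gridE a (x + z) = gridE a x := by
    funext j
    obtain ⟨n, hn⟩ := hz j
    refine Complex.exp_eq_exp_iff_exists_int.2 ⟨n, ?_⟩
    rw [inner_add_right, hn]
    push_cast
    ring
  rw [gridV, gridV, hE]

/-- Two vectors of a real inner product space with `⟪u, u⟫ = ⟪w, w⟫ = 4α` and `⟪u, w⟫ = -2α` are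
linearly independent. -/
lemma linearIndependent_pair_of_inner {E : Type*} [NormedAddCommGroup E] [InnerProductSpace ℝ E]
    {α : ℝ} (hα : α ≠ 0) {u w : E} (huu : ⟪u, u⟫ = 4 * α) (hww : ⟪w, w⟫ = 4 * α)
    (huw : ⟪u, w⟫ = -2 * α) : LinearIndependent ℝ ![u, w] := by
  rw [LinearIndependent.pair_iff]
  intro s t hst
  have hu : ⟪u, s • u + t • w⟫ = 0 := by rw [hst, inner_zero_right]
  have hw : ⟪w, s • u + t • w⟫ = 0 := by rw [hst, inner_zero_right]
  rw [inner_add_right, real_inner_smul_right, real_inner_smul_right, huu, huw] at hu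
  rw [inner_add_right, real_inner_smul_right, real_inner_smul_right, hww,
    real_inner_comm u w, huw] at hw
  have hs : α * s = 0 := by linear_combination hu / 3 + hw / 6
  have ht : α * t = 0 := by linear_combination hu / 6 + hw / 3
  exact ⟨(mul_eq_zero.1 hs).resolve_left hα, (mul_eq_zero.1 ht).resolve_left hα⟩

/-- global ambiguity of a single block: `a₁, a₂` are linearly
independent, there is a nonzero period `z` with `v(x + z) = v(x)` for all `x`,
and hence `x ↦ v(x)` is not injective. -/
theorem grid_global_ambiguity (α : ℝ) (hα : 0 < α)
    (a : Fin 3 → EuclideanSpace ℝ (Fin 2))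
    (hnorm : ∀ j, ‖a j‖ = 2 * Real.sqrt α)
    (hang : ∀ i j, i ≠ j → ⟪a i, a j⟫ = -2 * α)
    (C : Matrix (Fin 3) (Fin 3) ℂ) (hC : Cᴴ * C = 1) :
    LinearIndependent ℝ ![a 0, a 1] ∧
    (∃ z : EuclideanSpace ℝ (Fin 2), z ≠ 0 ∧
      ∀ x : EuclideanSpace ℝ (Fin 2), gridV C a (x + z) = gridV C a x) ∧
    ¬ Function.Injective (gridV C a) := by
  have hself (j) : ⟪a j, a j⟫ = 4 * α := by
    rw [real_inner_self_eq_norm_sq, hnorm, mul_pow, Real.sq_sqrt hα.le]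
    norm_num
  have hinner (j) : ⟪a j, (Real.pi / (3 * α)) • (a 0 - a 1)⟫ =
      Real.pi / (3 * α) * (⟪a j, a 0⟫ - ⟪a j, a 1⟫) := by
    rw [real_inner_smul_right, inner_sub_right]
  have hperiod : ∃ z : EuclideanSpace ℝ (Fin 2), z ≠ 0 ∧
      ∀ x : EuclideanSpace ℝ (Fin 2), gridV C a (x + z) = gridV C a x := by
    refine ⟨(Real.pi / (3 * α)) • (a 0 - a 1), fun h0 => ?_,
      gridV_add_eq_of_inner_eq_int_mul C fun j => ?_⟩
    · have h := hinner 0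
      rw [h0, inner_zero_right, hself, hang 0 1 (by decide)] at h
      field_simp at h
      linarith [Real.pi_pos]
    · fin_cases j
      · refine ⟨1, (hinner 0).trans ?_⟩
        rw [hself, hang 0 1 (by decide)]
        push_cast
        field_simp
        ring
      · refine ⟨-1, (hinner 1).trans ?_⟩
        rw [hself, hang 1 0 (by decide)]
        push_cast
        field_simp
        ring
      · refine ⟨0, (hinner 2).trans ?_⟩
        rw [hang 2 0 (by decide), hang 2 1 (by decide)]
        simp
  refine ⟨linearIndependent_pair_of_inner hα.ne' (hself 0) (hself 1) (hang 0 1 (by decide)),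
    hperiod, fun hinj => ?_⟩
  obtain ⟨z, hz0, hz⟩ := hperiod
  exact hz0 (add_eq_left.1 (hinj (hz 0)))
end
end

section
/- (Deterministic error correction.) Let x, y ∈ ℝ² and let ε ∈ ℂ³ be a noise vector with ‖ε‖ ≤ s, and set u = v(x) + ε. If Re⟨v(x), v(y)⟩ ≤ 3 − δ for some δ > 2s√3, then Re⟨u, v(y)⟩ < Re⟨u, v(x)⟩; that is, decoding by maximizing the real inner product with the codebook prefers the true position x over y. -/
open Matrix RealInnerProductSpace

noncomputable section

theorem hermInner_eq_inner (u w : Fin 3 → ℂ) :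
    hermInner u w = inner ℂ (WithLp.toLp 2 u) (WithLp.toLp 2 w) := by
  simp [hermInner, PiLp.inner_apply, mul_comm]

theorem hermInner_self_re (u : Fin 3 → ℂ) :
    (hermInner u u).re = ‖WithLp.toLp 2 u‖ ^ 2 := by
  rw [hermInner_eq_inner]
  exact inner_self_eq_norm_sq (𝕜 := ℂ) (WithLp.toLp 2 u)

theorem abs_hermInner_re_le (u w : Fin 3 → ℂ) :
    |(hermInner u w).re| ≤ √(hermInner u u).re * √(hermInner w w).re := by
  rw [hermInner_self_re, hermInner_self_re, Real.sqrt_sq (norm_nonneg _),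
    Real.sqrt_sq (norm_nonneg _), hermInner_eq_inner]
  exact (Complex.abs_re_le_norm _).trans (norm_inner_le_norm _ _)

theorem hermInner_add_left (u u' w : Fin 3 → ℂ) :
    hermInner (u + u') w = hermInner u w + hermInner u' w := by
  simp [hermInner, add_mul, Finset.sum_add_distrib]

theorem hermInner_gridE_self (a : Fin 3 → EuclideanSpace ℝ (Fin 2))
    (x : EuclideanSpace ℝ (Fin 2)) : hermInner (gridE a x) (gridE a x) = 3 := by
  simp [hermInner, gridE, ← Complex.exp_conj, ← Complex.exp_add]

theorem hermInner_mulVec {C : Matrix (Fin 3) (Fin 3) ℂ} (hC : Cᴴ * C = 1)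
    (u w : Fin 3 → ℂ) : hermInner (C *ᵥ u) (C *ᵥ w) = hermInner u w := by
  change star (C *ᵥ u) ⬝ᵥ (C *ᵥ w) = star u ⬝ᵥ w
  rw [Matrix.star_mulVec, ← Matrix.dotProduct_mulVec, Matrix.mulVec_mulVec, hC,
    Matrix.one_mulVec]

theorem hermInner_gridV_self {C : Matrix (Fin 3) (Fin 3) ℂ} (hC : Cᴴ * C = 1)
    (a : Fin 3 → EuclideanSpace ℝ (Fin 2)) (x : EuclideanSpace ℝ (Fin 2)) :
    hermInner (gridV C a x) (gridV C a x) = 3 :=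
  (hermInner_mulVec hC _ _).trans (hermInner_gridE_self a x)

/-- deterministic error correction: if `u = v(x) + ε` with
`‖ε‖ ≤ s`, and `Re⟨v(x), v(y)⟩ ≤ 3 − δ` with `δ > 2s√3`, then
`Re⟨u, v(y)⟩ < Re⟨u, v(x)⟩`. -/
theorem grid_error_correction (α : ℝ) (hα : 0 < α)
    (a : Fin 3 → EuclideanSpace ℝ (Fin 2))
    (hnorm : ∀ j, ‖a j‖ = 2 * Real.sqrt α)
    (hang : ∀ i j, i ≠ j → ⟪a i, a j⟫ = -2 * α)
    (C : Matrix (Fin 3) (Fin 3) ℂ) (hC : Cᴴ * C = 1)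
    (x y : EuclideanSpace ℝ (Fin 2)) (ε : Fin 3 → ℂ) (s δ : ℝ)
    (hε : Real.sqrt (hermInner ε ε).re ≤ s)
    (hδ : δ > 2 * s * Real.sqrt 3)
    (hfar : (hermInner (gridV C a x) (gridV C a y)).re ≤ 3 - δ) :
    (hermInner (gridV C a x + ε) (gridV C a y)).re
      < (hermInner (gridV C a x + ε) (gridV C a x)).re := by
  have noise_le (z : EuclideanSpace ℝ (Fin 2)) :
      |(hermInner ε (gridV C a z)).re| ≤ s * √3 := by
    refine (abs_hermInner_re_le _ _).trans ?_
    rw [hermInner_gridV_self hC, Complex.re_ofNat]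
    gcongr
  rw [hermInner_add_left, hermInner_add_left, hermInner_gridV_self hC, Complex.add_re,
    Complex.add_re, Complex.re_ofNat]
  have hx := (abs_le.mp (noise_le x)).1
  have hy := (abs_le.mp (noise_le y)).2
  linarith
end
end
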